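/- arXiv:2309.13290 — 2 statements merged into one kernel-verified Lean document; each statement's English description precedes it below -/
import Mathlib

section
/- Let (X,d) be a compact metric space, f : X → X a continuous map, and x ∈ Sh(f). Then x ∈ ⋃_{r>0,b>0} Ent_{r,b}(f) if and only if the topological entropy of f restricted to C(x) is positive, i.e. h(f, C(x)) > 0. -/
open Filter Topology Set

section Defs

variable {X : Type*} [MetricSpace X]

/-- `c 0, c 1, ..., c k` is a `δ`-chain of `f`. -/
def IsDeltaChain (f : X → X) (δ : ℝ) (c : ℕ → X) (k : ℕ) : Prop :=
  ∀ i < k, dist (f (c i)) (c (i + 1)) ≤ δ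

/-- `x → y` : for every `δ > 0` there is a `δ`-chain of `f` from `x` to `y`. -/
def ChainReach (f : X → X) (x y : X) : Prop :=
  ∀ δ > 0, ∃ (c : ℕ → X) (k : ℕ), 1 ≤ k ∧ IsDeltaChain f δ c k ∧ c 0 = x ∧ c k = y

/-- `C(x) = {x} ∪ {y : x → y}`. -/
def CSet (f : X → X) (x : X) : Set X := {x} ∪ {y | ChainReach f x y}

/-- The chain recurrent set. -/
def CR (f : X → X) : Set X := {x | ChainReach f x x}

/-- `C` is a chain component of `f` : an equivalence class of `↔` on `CR f`. -/
def IsChainComponent (f : X → X) (C : Set X) : Prop :=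
  ∃ x ∈ CR f, C = {y ∈ CR f | ChainReach f x y ∧ ChainReach f y x}

/-- A set `S` is chain stable for `f`. -/
def ChainStable (f : X → X) (S : Set X) : Prop :=
  ∀ ε > 0, ∃ δ > 0, ∀ (c : ℕ → X) (k : ℕ), 1 ≤ k → IsDeltaChain f δ c k → c 0 ∈ S →
    ∀ i ≤ k, Metric.infDist (c i) S ≤ ε

/-- `ξ` is a `δ`-pseudo orbit of `f`. -/
def IsPseudoOrbit (f : X → X) (δ : ℝ) (ξ : ℕ → X) : Prop :=
  ∀ i, dist (f (ξ i)) (ξ (i + 1)) ≤ δ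

/-- `x` is a shadowable point of `f`. -/
def ShadowablePt (f : X → X) (x : X) : Prop :=
  ∀ ε > 0, ∃ δ > 0, ∀ ξ : ℕ → X, IsPseudoOrbit f δ ξ → ξ 0 = x →
    ∃ y, ∀ i, dist (f^[i] y) (ξ i) ≤ ε

/-- `f` has the shadowing on `S`. -/
def ShadowingOn (f : X → X) (S : Set X) : Prop :=
  ∀ ε > 0, ∃ δ > 0, ∀ ξ : ℕ → X, IsPseudoOrbit f δ ξ → (∀ i, ξ i ∈ S) →
    ∃ y, ∀ i, dist (f^[i] y) (ξ i) ≤ ε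

/-- `f` has the shadowing property. -/
def ShadowingProperty (f : X → X) : Prop :=
  ∀ ε > 0, ∃ δ > 0, ∀ ξ : ℕ → X, IsPseudoOrbit f δ ξ →
    ∃ y, ∀ i, dist (f^[i] y) (ξ i) ≤ ε

/-- `f` is chain transitive. -/
def ChainTransitive (f : X → X) : Prop := ∀ x y : X, ChainReach f x y

/-- `f` restricted to `S` is chain continuous. -/
def ChainContinuousOn (f : X → X) (S : Set X) : Prop :=
  ∀ ε > 0, ∃ δ > 0, ∀ ξ η : ℕ → X, IsPseudoOrbit f δ ξ → IsPseudoOrbit f δ η →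
    (∀ i, ξ i ∈ S) → (∀ i, η i ∈ S) → ξ 0 = η 0 → ∀ i, dist (ξ i) (η i) ≤ ε

/-- `f` restricted to `S` is equicontinuous. -/
def EquicontinuousOnSet (f : X → X) (S : Set X) : Prop :=
  ∀ ε > 0, ∃ δ > 0, ∀ x ∈ S, ∀ y ∈ S, dist x y ≤ δ → ∀ i : ℕ, dist (f^[i] x) (f^[i] y) ≤ ε

/-- `s_n(f,K,r)` : largest cardinality of an `(n,r)`-separated subset of `K`. -/
noncomputable def sepNum (f : X → X) (K : Set X) (n : ℕ) (r : ℝ) : ℕ :=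
  sSup {m | ∃ E : Finset X, (E : Set X) ⊆ K ∧
    (∀ x ∈ E, ∀ y ∈ E, x ≠ y → ∃ i < n, r < dist (f^[i] x) (f^[i] y)) ∧ E.card = m}

/-- `h(f,K,r) = limsup (1/n) log s_n(f,K,r)`. -/
noncomputable def entH (f : X → X) (K : Set X) (r : ℝ) : EReal :=
  Filter.limsup (fun n : ℕ => ((Real.log (sepNum f K n r) / n : ℝ) : EReal)) Filter.atTop

/-- `h(f,K) = lim_{r → 0} h(f,K,r) = sup_{r > 0} h(f,K,r)`. -/
noncomputable def ent (f : X → X) (K : Set X) : EReal :=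
  ⨆ r ∈ Set.Ioi (0 : ℝ), entH f K r

/-- `Ent_r(f)`. -/
def EntR (f : X → X) (r : ℝ) : Set X :=
  {x | ∀ K : Set X, IsClosed K → K ∈ 𝓝 x → 0 < entH f K r}

/-- `Ent_{r,b}(f)`. -/
def EntRB (f : X → X) (r b : ℝ) : Set X :=
  {x | ∀ K : Set X, IsClosed K → K ∈ 𝓝 x → (b : EReal) ≤ entH f K r}

/-- The ω-limit set of `x` under `f`. -/
def omegaLim (f : X → X) (x : X) : Set X :=
  {y | ∃ φ : ℕ → ℕ, StrictMono φ ∧ Tendsto (fun j => f^[φ j] x) atTop (𝓝 y)}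

/-- The set of `e`-sensitive points of `f` restricted to `S`. -/
def SenE (f : X → X) (S : Set X) (e : ℝ) : Set X :=
  {x ∈ S | ∀ ε > 0, ∃ y ∈ S, dist x y ≤ ε ∧ ∃ i : ℕ, e < dist (f^[i] x) (f^[i] y)}

/-- `Sen(f|_S) = ⋃_{e > 0} Sen_e(f|_S)`. -/
def Sen (f : X → X) (S : Set X) : Set X := ⋃ e ∈ Set.Ioi (0 : ℝ), SenE f S e

/-- `(x,y)` is a scrambled pair for `f`. -/
def ScrambledPair (f : X → X) (x y : X) : Prop :=
  0 < Filter.limsup (fun i : ℕ => dist (f^[i] x) (f^[i] y)) Filter.atTop ∧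
    Filter.liminf (fun i : ℕ => dist (f^[i] x) (f^[i] y)) Filter.atTop = 0

/-- `M` is a minimal set for `f`. -/
def IsMinimalSet (f : X → X) (M : Set X) : Prop :=
  IsClosed M ∧ MapsTo f M M ∧ ∀ S ⊆ M, IsClosed S → MapsTo f S S → S = ∅ ∨ S = M

/-- `Φ_ε(x)`. -/
def Phi (f : X → X) (ε : ℝ) (x : X) : Set X :=
  {y | ∀ i : ℕ, dist (f^[i] x) (f^[i] y) ≤ ε}

/-- `h*_f(ε) = sup_x h(f,Φ_ε(x))`. -/
noncomputable def hStar (f : X → X) (ε : ℝ) : EReal := ⨆ x : X, ent f (Phi f ε x)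

/-- `f` is h-expansive. -/
def HExpansive (f : X → X) : Prop := ∃ ε > 0, hStar f ε = 0

end Defs

section Separated

variable {X : Type*} [MetricSpace X] {f : X → X}

/-- `E` is an `(n, r)`-separated finite set for `f`. -/
def IsDynSeparated (f : X → X) (n : ℕ) (r : ℝ) (E : Finset X) : Prop :=
  ∀ x ∈ E, ∀ y ∈ E, x ≠ y → ∃ i < n, r < dist (f^[i] x) (f^[i] y)

theorem isOpen_dynBall (hf : Continuous f) (n : ℕ) (r : ℝ) (p : X) :
    IsOpen {z | ∀ i < n, dist (f^[i] z) (f^[i] p) < r} := by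
  have : {z | ∀ i < n, dist (f^[i] z) (f^[i] p) < r} =
      ⋂ i ∈ Finset.range n, {z | dist (f^[i] z) (f^[i] p) < r} := by
    ext z; simp
  rw [this]
  exact isOpen_biInter_finset fun i _ =>
    isOpen_lt ((hf.iterate i).dist continuous_const) continuous_const

theorem bddAbove_card_separated [CompactSpace X] (hf : Continuous f) (K : Set X) (n : ℕ) {r : ℝ}
    (hr : 0 < r) :
    BddAbove {m | ∃ E : Finset X, (E : Set X) ⊆ K ∧ IsDynSeparated f n r E ∧ E.card = m} := by
  obtain ⟨t, ht⟩ := CompactSpace.elim_nhds_subcover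
    (fun p => {z | ∀ i < n, dist (f^[i] z) (f^[i] p) < r / 2})
    (fun p => (isOpen_dynBall hf n (r / 2) p).mem_nhds (by simpa using fun _ _ => hr))
  refine ⟨t.card, ?_⟩
  rintro _ ⟨E, -, hE, rfl⟩
  have h : ∀ z : X, ∃ p ∈ t, ∀ i < n, dist (f^[i] z) (f^[i] p) < r / 2 := fun z => by
    have : z ∈ (⊤ : Set X) := trivial
    rw [← ht] at this
    simpa using this
  choose c hct hc using h
  refine Finset.card_le_card_of_injOn c (fun z _ => hct z) fun z hz w hw hzw => ?_
  by_contra hne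
  obtain ⟨i, hi, hlt⟩ := hE z hz w hw hne
  have h1 := hc z i hi
  have h2 := hc w i hi
  rw [← hzw] at h2
  linarith [dist_triangle_right (f^[i] z) (f^[i] w) (f^[i] (c z))]

theorem card_le_sepNum [CompactSpace X] (hf : Continuous f) {K : Set X} {n : ℕ} {r : ℝ}
    (hr : 0 < r) {E : Finset X} (hEK : (E : Set X) ⊆ K) (hE : IsDynSeparated f n r E) :
    E.card ≤ sepNum f K n r :=
  le_csSup (bddAbove_card_separated hf K n hr) ⟨E, hEK, hE, rfl⟩

theorem exists_card_eq_sepNum [CompactSpace X] (hf : Continuous f) (K : Set X) (n : ℕ) {r : ℝ}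
    (hr : 0 < r) :
    ∃ E : Finset X, (E : Set X) ⊆ K ∧ IsDynSeparated f n r E ∧ E.card = sepNum f K n r :=
  Nat.sSup_mem (s := {m | ∃ E : Finset X, (E : Set X) ⊆ K ∧ IsDynSeparated f n r E ∧ E.card = m})
    ⟨0, ∅, by simp, by simp [IsDynSeparated], rfl⟩ (bddAbove_card_separated hf K n hr)

/-- A separated set of maximal cardinality is spanning. -/
theorem exists_spanning_card_eq_sepNum [CompactSpace X] (hf : Continuous f) (K : Set X) (n : ℕ)
    {r : ℝ} (hr : 0 < r) :
    ∃ E : Finset X, E.card = sepNum f K n r ∧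
      ∀ z ∈ K, ∃ p ∈ E, ∀ i < n, dist (f^[i] z) (f^[i] p) ≤ r := by
  classical
  obtain ⟨E, hEK, hE, hcard⟩ := exists_card_eq_sepNum hf K n hr
  refine ⟨E, hcard, fun z hz => ?_⟩
  by_contra! hfar
  have hzE : z ∉ E := fun h => by
    obtain ⟨i, -, hi⟩ := hfar z h
    rw [dist_self] at hi
    linarith
  have hsep : IsDynSeparated f n r (insert z E) := by
    intro u hu v hv huv
    rcases Finset.mem_insert.1 hu with hu | hu <;> rcases Finset.mem_insert.1 hv with hv | hv
    · exact absurd (hu.trans hv.symm) huv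
    · exact hu ▸ hfar v hv
    · simpa only [hv, dist_comm] using hfar u hu
    · exact hE u hu v hv huv
  have := card_le_sepNum hf hr (K := K) (by
    rw [Finset.coe_insert]; exact Set.insert_subset hz hEK) hsep
  rw [Finset.card_insert_of_notMem hzE] at this
  omega

/-- If every orbit from `K` is, at all times, `(n, r / 2)`-close to a point of `E`, then
`(m, r)`-separated subsets of `K` have at most `|E| ^ (m / n + 1)` elements. -/
theorem sepNum_le_pow [CompactSpace X] (hf : Continuous f) {K : Set X} {n : ℕ} (hn : 0 < n)
    {r : ℝ} (hr : 0 < r) (E : Finset X)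
    (hE : ∀ z ∈ K, ∀ j, ∃ p ∈ E, ∀ i < n, dist (f^[i] (f^[j] z)) (f^[i] p) < r / 2) (m : ℕ) :
    sepNum f K m r ≤ E.card ^ (m / n + 1) := by
  classical
  obtain ⟨F, hFK, hF, hcard⟩ := exists_card_eq_sepNum hf K m hr
  rw [← hcard]
  have h : ∀ z j, ∃ p, z ∈ F → p ∈ E ∧ ∀ i < n, dist (f^[i] (f^[j] z)) (f^[i] p) < r / 2 := by
    intro z j
    by_cases hz : z ∈ F
    · obtain ⟨p, hp⟩ := hE z (hFK hz) j
      exact ⟨p, fun _ => hp⟩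
    · exact ⟨z, fun h => absurd h hz⟩
  choose c hc using h
  have hle := Finset.card_le_card_of_injOn (s := F)
    (t := Fintype.piFinset fun _ : Fin (m / n + 1) => E) (fun z j => c z (j * n))
    (fun z hz => by
      simp only [Finset.mem_coe, Fintype.mem_piFinset]
      exact fun j => (hc z _ hz).1)
    (fun z hz w hw hzw => by
      by_contra hne
      obtain ⟨i, hi, hlt⟩ := hF z hz w hw hne
      have hj : i / n < m / n + 1 := Nat.lt_succ_of_le (Nat.div_le_div_right hi.le)
      have heq : c z (i / n * n) = c w (i / n * n) := congrFun hzw ⟨i / n, hj⟩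
      have h1 := (hc z (i / n * n) hz).2 (i % n) (Nat.mod_lt _ hn)
      have h2 := (hc w (i / n * n) hw).2 (i % n) (Nat.mod_lt _ hn)
      rw [← Function.iterate_add_apply, Nat.mod_add_div'] at h1 h2
      rw [← heq] at h2
      linarith [dist_triangle_right (f^[i] z) (f^[i] w) (f^[i % n] (c z (i / n * n)))])
  simpa using hle

end Separated

section Chains

variable {X : Type*} [MetricSpace X] {f : X → X} {x : X}

/-- Orbits starting close to `x` stay in any given open neighbourhood of `CSet f x`. -/
theorem exists_forall_iterate_mem_of_CSet_subset [CompactSpace X] (hf : Continuous f) {N : Set X}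
    (hN : IsOpen N) (hsub : CSet f x ⊆ N) :
    ∃ ε > 0, ∀ z ∈ Metric.closedBall x ε, ∀ j, f^[j] z ∈ N := by
  by_contra! H
  have hpos : ∀ k : ℕ, (0 : ℝ) < 1 / ((k : ℝ) + 1) := fun k => by positivity
  choose z hz j hj using fun k : ℕ => H _ (hpos k)
  have hzx : Tendsto z atTop (𝓝 x) :=
    tendsto_iff_dist_tendsto_zero.2 (squeeze_zero (fun _ => dist_nonneg)
      (fun k => Metric.mem_closedBall.1 (hz k)) tendsto_one_div_add_atTop_nhds_zero_nat)
  obtain ⟨w, hw, φ, hφ, hlim⟩ := hN.isClosed_compl.isCompact.tendsto_subseq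
    (x := fun k => f^[j k] (z k)) hj
  refine hw (hsub ?_)
  by_cases hwx : w = x
  · exact Or.inl hwx
  refine Or.inr fun δ hδ => ?_
  have hzφ : Tendsto (fun k => z (φ k)) atTop (𝓝 x) := hzx.comp hφ.tendsto_atTop
  have hfz : Tendsto (fun k => f (z (φ k))) atTop (𝓝 (f x)) := (hf.tendsto x).comp hzφ
  have hd : 0 < dist w x / 2 := by have := dist_pos.2 hwx; linarith
  obtain ⟨k, hk1, hk2, hk3, hk4⟩ :=
    ((hfz.eventually (Metric.ball_mem_nhds _ (half_pos hδ))).and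
    ((hlim.eventually (Metric.ball_mem_nhds _ (half_pos hδ))).and
    ((hzφ.eventually (Metric.ball_mem_nhds _ hd)).and
    (hlim.eventually (Metric.ball_mem_nhds _ hd))))).exists
  simp only [Function.comp_apply] at hk1 hk2 hk3 hk4
  set u := z (φ k)
  set m := j (φ k)
  have hm : 1 ≤ m := by
    rcases Nat.eq_zero_or_pos m with h | h
    · rw [h, Function.iterate_zero_apply] at hk4
      linarith [dist_triangle_left w x u]
    · exact h
  refine ⟨fun i => if i = 0 then x else if i = m then w else f^[i] u, m, hm, ?_, by simp, ?_⟩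
  · intro i hi
    have hstart : dist (f (if i = 0 then x else if i = m then w else f^[i] u)) (f^[i + 1] u)
        ≤ δ / 2 := by
      by_cases h0 : i = 0
      · subst h0
        simpa [dist_comm] using hk1.le
      · rw [if_neg h0, if_neg hi.ne, Function.iterate_succ_apply', dist_self]
        linarith
    have hend : dist (f^[i + 1] u) (if i + 1 = m then w else f^[i + 1] u) ≤ δ / 2 := by
      by_cases h1 : i + 1 = m
      · rw [if_pos h1, h1]; exact hk2.le
      · rw [if_neg h1, dist_self]; linarith
    simp only [Nat.add_eq_zero_iff, one_ne_zero, and_false, if_false]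
    linarith [dist_triangle (f (if i = 0 then x else if i = m then w else f^[i] u)) (f^[i + 1] u)
      (if i + 1 = m then w else f^[i + 1] u)]
  · simp [show m ≠ 0 by omega]

/-- Points of `CSet f x` are reached from `x` by `δ`-chains of uniformly bounded length. -/
theorem exists_bound_length_deltaChain [CompactSpace X] (f : X → X) (x : X) {δ : ℝ} (hδ : 0 < δ) :
    ∃ L : ℕ, ∀ y ∈ CSet f x, ∃ (c : ℕ → X) (k : ℕ),
      k ≤ L ∧ IsDeltaChain f δ c k ∧ c 0 = x ∧ c k = y := by
  have hS : TotallyBounded {y | ChainReach f x y} :=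
    isCompact_univ.totallyBounded.subset (subset_univ _)
  obtain ⟨t, hts, htf, hcov⟩ := totallyBounded_iff_subset.1 hS _
    (Metric.dist_mem_uniformity (half_pos hδ))
  have h : ∀ p, ∃ (c : ℕ → X) (k : ℕ), p ∈ t →
      1 ≤ k ∧ IsDeltaChain f (δ / 2) c k ∧ c 0 = x ∧ c k = p := by
    intro p
    by_cases hp : p ∈ t
    · obtain ⟨c, k, h⟩ := hts hp _ (half_pos hδ)
      exact ⟨c, k, fun _ => h⟩
    · exact ⟨fun _ => x, 0, fun h => absurd h hp⟩
  choose c k hck using h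
  refine ⟨htf.toFinset.sup k, ?_⟩
  rintro y (hy | hy)
  · exact ⟨fun _ => x, 0, Nat.zero_le _, fun i hi => absurd hi (Nat.not_lt_zero i), rfl, hy.symm⟩
  · obtain ⟨p, hp, hyp⟩ : ∃ p ∈ t, dist y p < δ / 2 := by simpa using hcov hy
    obtain ⟨hk1, hch, h0, hkp⟩ := hck p hp
    refine ⟨Function.update (c p) (k p) y, k p,
      Finset.le_sup (f := k) (htf.mem_toFinset.2 hp), ?_, ?_, by simp⟩
    · intro i hi
      rw [Function.update_of_ne hi.ne]
      have hi' := hch i hi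
      by_cases h1 : i + 1 = k p
      · rw [h1, Function.update_self]
        rw [h1, hkp] at hi'
        linarith [dist_triangle_right (f (c p i)) y p]
      · rw [Function.update_of_ne h1]
        linarith
    · rw [Function.update_of_ne (by omega), h0]

/-- Following a `δ`-chain by the orbit of its last point gives a `δ`-pseudo orbit. -/
theorem IsDeltaChain.exists_pseudoOrbit {δ : ℝ} (hδ : 0 ≤ δ) {c : ℕ → X} {k : ℕ}
    (hc : IsDeltaChain f δ c k) :
    ∃ ξ : ℕ → X, IsPseudoOrbit f δ ξ ∧ ξ 0 = c 0 ∧ ∀ i, ξ (i + k) = f^[i] (c k) := by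
  refine ⟨fun i => if i < k then c i else f^[i - k] (c k), fun i => ?_, ?_, fun i => by simp⟩
  · rcases lt_trichotomy (i + 1) k with h | h | h
    · simpa [h, Nat.lt_of_succ_lt h] using hc i (Nat.lt_of_succ_lt h)
    · subst h
      simpa using hc i (Nat.lt_succ_self i)
    · have h1 : ¬ i < k := by omega
      have h2 : ¬ i + 1 < k := by omega
      simp only [h1, h2, if_false]
      rw [Nat.sub_add_comm (by omega : k ≤ i), Function.iterate_succ_apply', dist_self]
      exact hδ
  · by_cases h : 0 < k
    · simp [h]
    · obtain rfl : k = 0 := by omega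
      simp

/-- Near a shadowable point, the separated sets of `CSet f x` can be traced. -/
theorem ShadowablePt.exists_sepNum_le [CompactSpace X] (hf : Continuous f) (hx : ShadowablePt f x)
    {r ε : ℝ} (hr : 0 < r) (hε : 0 < ε) (hεr : 2 * ε ≤ r / 2) :
    ∃ L : ℕ, ∀ n, sepNum f (CSet f x) n r ≤
      (L + 1) * sepNum f (Metric.closedBall x ε) (n + L) (r / 2) := by
  classical
  obtain ⟨δ, hδ, hsh⟩ := hx ε hε
  obtain ⟨L, hL⟩ := exists_bound_length_deltaChain f x hδ
  refine ⟨L, fun n => ?_⟩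
  obtain ⟨E, hEK, hE, hcard⟩ := exists_card_eq_sepNum hf (CSet f x) n hr
  have h : ∀ y, ∃ (z : X) (k : ℕ), y ∈ E → k ≤ L ∧ z ∈ Metric.closedBall x ε ∧
      ∀ i, dist (f^[i + k] z) (f^[i] y) ≤ ε := by
    intro y
    by_cases hy : y ∈ E
    · obtain ⟨c, k, hkL, hc, hc0, hck⟩ := hL y (hEK hy)
      obtain ⟨ξ, hξ, hξ0, hξk⟩ := hc.exists_pseudoOrbit hδ.le
      obtain ⟨z, hz⟩ := hsh ξ hξ (hξ0.trans hc0)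
      refine ⟨z, k, fun _ => ⟨hkL, ?_, fun i => ?_⟩⟩
      · simpa [hξ0, hc0] using hz 0
      · rw [← hck, ← hξk]
        exact hz (i + k)
    · exact ⟨y, 0, fun h => absurd h hy⟩
  choose z k hzk using h
  rw [← hcard]
  have hfib := Finset.card_le_mul_card_image_of_maps_to (s := E) (t := Finset.range (L + 1))
    (f := k) (fun y hy => Finset.mem_range.2 (Nat.lt_succ_of_le (hzk y hy).1))
    (sepNum f (Metric.closedBall x ε) (n + L) (r / 2)) (fun l hl => by
      have hsep : ∀ u ∈ E.filter (fun y => k y = l), ∀ v ∈ E.filter (fun y => k y = l), u ≠ v →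
          ∃ i < n + L, r / 2 < dist (f^[i] (z u)) (f^[i] (z v)) := by
        intro u hu v hv huv
        obtain ⟨huE, rfl⟩ := Finset.mem_filter.1 hu
        obtain ⟨hvE, hkv⟩ := Finset.mem_filter.1 hv
        obtain ⟨i, hi, hlt⟩ := hE u huE v hvE huv
        obtain ⟨hkL, -, h1⟩ := hzk u huE
        have h2 := (hzk v hvE).2.2 i
        rw [hkv] at h2
        refine ⟨i + k u, by omega, ?_⟩
        have h3 := dist_triangle4_left (f^[i + k u] (z u)) (f^[i + k u] (z v)) (f^[i] u) (f^[i] v)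
        linarith [h1 i]
      have hinj : Set.InjOn z (E.filter (fun y => k y = l)) := by
        intro u hu v hv huv
        by_contra hne
        obtain ⟨i, -, hi⟩ := hsep u hu v hv hne
        rw [huv, dist_self] at hi
        linarith
      rw [← Finset.card_image_of_injOn hinj]
      refine card_le_sepNum hf (half_pos hr) ?_ ?_
      · intro w hw
        obtain ⟨u, hu, rfl⟩ := Finset.mem_image.1 (Finset.mem_coe.1 hw)
        exact (hzk u (Finset.mem_filter.1 hu).1).2.1
      · intro w hw w' hw' hne
        obtain ⟨u, hu, rfl⟩ := Finset.mem_image.1 hw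
        obtain ⟨v, hv, rfl⟩ := Finset.mem_image.1 hw'
        exact hsep u hu v hv fun h => hne (h ▸ rfl))
  simpa [mul_comm] using hfib

end Chains

section Entropy

variable {X : Type*} [MetricSpace X] {f : X → X} {x : X}

theorem sepNum_mono [CompactSpace X] (hf : Continuous f) {K K' : Set X} (h : K ⊆ K') (n : ℕ)
    {r : ℝ} (hr : 0 < r) : sepNum f K n r ≤ sepNum f K' n r := by
  obtain ⟨E, hEK, hE, hcard⟩ := exists_card_eq_sepNum hf K n hr
  exact hcard ▸ card_le_sepNum hf hr (hEK.trans h) hE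

theorem ent_CSet_pos_of_mem_EntRB [CompactSpace X] (hf : Continuous f) {r b : ℝ} (hr : 0 < r)
    (hb : 0 < b) (hx : x ∈ EntRB f r b) : 0 < ent f (CSet f x) := by
  by_contra hent
  have hr4 : 0 < r / 4 := by linarith
  have hlt : entH f (CSet f x) (r / 4) < ((b / 2 : ℝ) : EReal) :=
    ((le_iSup₂ (f := fun s (_ : s ∈ Set.Ioi (0 : ℝ)) => entH f (CSet f x) s) (r / 4) hr4).trans
      (not_lt.1 hent)).trans_lt (by exact_mod_cast half_pos hb)
  obtain ⟨n, hn, hn0⟩ := ((eventually_lt_of_limsup_lt hlt).and (eventually_gt_atTop 0)).exists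
  rw [EReal.coe_lt_coe_iff] at hn
  obtain ⟨E, hEcard, hE⟩ := exists_spanning_card_eq_sepNum hf (CSet f x) n hr4
  rw [← hEcard] at hn
  have hn0' : (0 : ℝ) < n := by exact_mod_cast hn0
  obtain ⟨ε, hε, hstay⟩ := exists_forall_iterate_mem_of_CSet_subset hf (x := x)
    (N := ⋃ p ∈ E, {z | ∀ i < n, dist (f^[i] z) (f^[i] p) < r / 2})
    (isOpen_biUnion fun p _ => isOpen_dynBall hf n (r / 2) p) (fun z hz => by
      obtain ⟨p, hp, h⟩ := hE z hz
      exact Set.mem_biUnion (s := (E : Set X)) hp fun i hi => by linarith [h i hi])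
  have hK : ∀ m, sepNum f (Metric.closedBall x ε) m r ≤ E.card ^ (m / n + 1) :=
    sepNum_le_pow hf hn0 hr E fun z hz j => by simpa using hstay z hz j
  set a := Real.log E.card
  have ha : 0 ≤ a := Real.log_natCast_nonneg _
  have hlog : ∀ m, Real.log (sepNum f (Metric.closedBall x ε) m r) ≤ (m / n + 1) * a := by
    intro m
    rcases Nat.eq_zero_or_pos (sepNum f (Metric.closedBall x ε) m r) with h0 | h0
    · rw [h0, Nat.cast_zero, Real.log_zero]
      positivity
    · calc Real.log (sepNum f (Metric.closedBall x ε) m r)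
          ≤ Real.log ((E.card : ℝ) ^ (m / n + 1)) :=
            Real.log_le_log (by exact_mod_cast h0) (by exact_mod_cast hK m)
        _ = ((m / n : ℕ) + 1 : ℝ) * a := by rw [Real.log_pow]; push_cast; rfl
        _ ≤ (m / n + 1) * a := by
            gcongr
            exact Nat.cast_div_le
  have hle : entH f (Metric.closedBall x ε) r ≤ ((3 * b / 4 : ℝ) : EReal) := by
    refine limsup_le_of_le (by isBoundedDefault) ?_
    filter_upwards [eventually_gt_atTop 0, eventually_ge_atTop ⌈4 * a / b⌉₊] with m hm hm'
    have hm0 : (0 : ℝ) < m := by exact_mod_cast hm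
    rw [EReal.coe_le_coe_iff, div_le_iff₀ hm0]
    have h1 := Nat.ceil_le.1 hm'
    rw [div_le_iff₀ hb] at h1
    have h2 : (m / n + 1 : ℝ) * a = m * (a / n) + a := by ring
    have h3 : (m : ℝ) * (a / n) ≤ m * (b / 2) := by gcongr
    linarith [hlog m]
  have hge := hx _ Metric.isClosed_closedBall (Metric.closedBall_mem_nhds x hε)
  have := hge.trans hle
  rw [EReal.coe_le_coe_iff] at this
  linarith

theorem ShadowablePt.exists_mem_EntRB [CompactSpace X] (hf : Continuous f) (hx : ShadowablePt f x)
    (h : 0 < ent f (CSet f x)) : ∃ r > 0, ∃ b > 0, x ∈ EntRB f r b := by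
  obtain ⟨r, hr, hpos⟩ : ∃ r > 0, 0 < entH f (CSet f x) r := by
    simpa [ent, lt_iSup_iff] using h
  obtain ⟨b, hb0, hb⟩ := EReal.lt_iff_exists_real_btwn.1 hpos
  have hb0 : 0 < b := by exact_mod_cast hb0
  refine ⟨r / 2, half_pos hr, b / 2, half_pos hb0, fun K _ hK => ?_⟩
  obtain ⟨ε', hε', hsub⟩ := Metric.nhds_basis_closedBall.mem_iff.1 hK
  obtain ⟨L, hL⟩ := hx.exists_sepNum_le hf hr (lt_min hε' (by linarith : 0 < r / 4))
    (by linarith [min_le_right ε' (r / 4)])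
  have hsub' := (Metric.closedBall_subset_closedBall (min_le_left ε' (r / 4))).trans hsub
  have hfreq : ∃ᶠ n : ℕ in atTop,
      (b : EReal) < ((Real.log (sepNum f (CSet f x) n r) / n : ℝ) : EReal) :=
    frequently_lt_of_lt_limsup (by isBoundedDefault) hb
  set A := Real.log (L + 1)
  have hshift : ∃ᶠ n : ℕ in atTop,
      b / 2 ≤ Real.log (sepNum f K (n + L) (r / 2)) / (n + L : ℕ) := by
    refine (hfreq.and_eventually ((eventually_gt_atTop 0).and
      (eventually_ge_atTop ⌈2 * A / b + L⌉₊))).mono ?_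
    rintro n ⟨hn, hn0, hn1⟩
    have hn0' : (0 : ℝ) < n := by exact_mod_cast hn0
    rw [EReal.coe_lt_coe_iff, lt_div_iff₀ hn0'] at hn
    have hs : sepNum f (CSet f x) n r ≠ 0 := fun h0 => by
      rw [h0, Nat.cast_zero, Real.log_zero] at hn
      linarith [mul_pos hb0 hn0']
    have hle : sepNum f (CSet f x) n r ≤ (L + 1) * sepNum f K (n + L) (r / 2) :=
      (hL n).trans (Nat.mul_le_mul_left _ (sepNum_mono hf hsub' _ (half_pos hr)))
    have hs' : sepNum f K (n + L) (r / 2) ≠ 0 := fun h0 => by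
      rw [h0, mul_zero] at hle
      omega
    have hlog : Real.log (sepNum f (CSet f x) n r) ≤
        A + Real.log (sepNum f K (n + L) (r / 2)) := by
      rw [← Real.log_mul (by positivity) (by exact_mod_cast hs')]
      exact Real.log_le_log (by exact_mod_cast Nat.pos_of_ne_zero hs) (by exact_mod_cast hle)
    have h1 := Nat.ceil_le.1 hn1
    have h2 : 2 * A / b * b = 2 * A := by field_simp
    have h3 : (2 * A / b + L) * b ≤ n * b := by gcongr
    rw [le_div_iff₀ (by positivity)]
    push_cast
    linarith
  refine le_limsup_of_frequently_le ?_ (by isBoundedDefault)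
  refine Filter.Tendsto.frequently (tendsto_add_atTop_nat L) (hshift.mono fun n hn => ?_)
  exact EReal.coe_le_coe_iff.2 hn

end Entropy

/-- Theorem 1.2: for `x ∈ Sh(f)`, `x ∈ ⋃_{r,b>0} Ent_{r,b}(f)` iff `h(f,C(x)) > 0`. -/
theorem stmt_3 {X : Type*} [MetricSpace X] [CompactSpace X] (f : X → X)
    (hf : Continuous f) (x : X) (hx : ShadowablePt f x) :
    (∃ r > 0, ∃ b > 0, x ∈ EntRB f r b) ↔ 0 < ent f (CSet f x) :=
  ⟨fun ⟨_, hr, _, hb, h⟩ => ent_CSet_pos_of_mem_EntRB hf hr hb h, hx.exists_mem_EntRB hf⟩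
end

section
/- Let (X,d) be a compact metric space, f : X → X a continuous map, x ∈ X, and C a chain component of f with ω(x,f) ⊆ C. If there exists y ∈ X such that (x,y) is a scrambled pair for f, then f|_C : C → C is not chain continuous. -/
open Filter Topology Set

theorem ChainReach.trans {X : Type*} [MetricSpace X] {f : X → X} {x y z : X}
    (hxy : ChainReach f x y) (hyz : ChainReach f y z) : ChainReach f x z := by
  intro δ hδ
  obtain ⟨c, k, hk, hc, hc0, hck⟩ := hxy δ hδ
  obtain ⟨d, l, hl, hd, hd0, hdl⟩ := hyz δ hδ
  refine ⟨fun i => if i ≤ k then c i else d (i - k), k + l, by omega, fun i hi => ?_, ?_, ?_⟩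
  · rcases lt_trichotomy i k with h | h | h
    · simpa [h.le, Nat.succ_le_of_lt h] using hc i h
    · subst h
      simpa [hck, ← hd0] using hd 0 (by omega)
    · have h₁ : i + 1 - k = (i - k) + 1 := by omega
      simpa [not_le.2 h, show ¬ i + 1 ≤ k by omega, h₁] using hd (i - k) (by omega)
  · simpa using hc0
  · simpa [show l ≠ 0 by omega] using hdl

/-- Any two points of an ω-limit set are joined by chains. -/
theorem chainReach_of_mem_omegaLim {X : Type*} [MetricSpace X] {f : X → X} (hf : Continuous f)
    {y z w : X} (hz : z ∈ omegaLim f y) (hw : w ∈ omegaLim f y) : ChainReach f z w := by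
  intro δ hδ
  obtain ⟨φ, -, hφlim⟩ := hz
  obtain ⟨ψ, hψ, hψlim⟩ := hw
  obtain ⟨j, hj⟩ :=
    ((Metric.tendsto_nhds.1 ((hf.tendsto z).comp hφlim)) δ hδ).exists
  obtain ⟨m, hm, hmj⟩ := ((Metric.tendsto_nhds.1 hψlim δ hδ).and
    (hψ.tendsto_atTop.eventually_ge_atTop (φ j + 2))).exists
  simp only [Function.comp_apply] at hj
  refine ⟨fun i => if i = 0 then z else if i = ψ m - φ j then w else f^[φ j + i] y,
    ψ m - φ j, by omega, fun i hi => ?_, by simp,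
    by simp [show ψ m - φ j ≠ 0 by omega]⟩
  rcases Nat.eq_zero_or_pos i with rfl | h0
  · simpa [show 1 ≠ ψ m - φ j by omega, Function.iterate_succ_apply', dist_comm] using hj.le
  · by_cases h : i + 1 = ψ m - φ j
    · have hi' : φ j + i + 1 = ψ m := by omega
      have hne : ψ m - φ j ≠ 0 := by omega
      simpa [h0.ne', hi.ne, h, hne, ← Function.iterate_succ_apply' f, hi'] using hm.le
    · simp [h0.ne', hi.ne, h, ← Function.iterate_succ_apply' f, ← add_assoc, hδ.le]

theorem IsChainComponent.omegaLim_subset {X : Type*} [MetricSpace X] {f : X → X}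
    (hf : Continuous f) {C : Set X} (hC : IsChainComponent f C) {y z : X} (hzC : z ∈ C)
    (hz : z ∈ omegaLim f y) : omegaLim f y ⊆ C := by
  obtain ⟨a, -, rfl⟩ := hC
  obtain ⟨-, haz, hza⟩ := hzC
  intro w hw
  have hzw := chainReach_of_mem_omegaLim hf hz hw
  have hwz := chainReach_of_mem_omegaLim hf hw hz
  exact ⟨hwz.trans hzw, haz.trans hzw, hwz.trans hza⟩

theorem eventually_exists_dist_lt_of_omegaLim_subset {X : Type*} [MetricSpace X] [CompactSpace X]
    {f : X → X} {y : X} {C : Set X} (h : omegaLim f y ⊆ C) {ε : ℝ} (hε : 0 < ε) :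
    ∀ᶠ n in atTop, ∃ c ∈ C, dist (f^[n] y) c < ε := by
  by_contra hcon
  obtain ⟨φ, hφ, hfar⟩ := extraction_of_frequently_atTop (not_eventually.1 hcon)
  obtain ⟨w, ψ, hψ, hlim⟩ := CompactSpace.tendsto_subseq (fun n => f^[φ n] y)
  have hw : w ∈ omegaLim f y := ⟨φ ∘ ψ, hφ.comp hψ, hlim⟩
  obtain ⟨j, hj⟩ := (Metric.tendsto_nhds.1 hlim ε hε).exists
  exact hfar (ψ j) ⟨w, h hw, hj⟩

theorem exists_mem_omegaLim_inter_of_frequently {X : Type*} [MetricSpace X] [CompactSpace X]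
    {f : X → X} {x y : X} (h : ∀ ε > 0, ∃ᶠ n in atTop, dist (f^[n] x) (f^[n] y) < ε) :
    ∃ z, z ∈ omegaLim f x ∧ z ∈ omegaLim f y := by
  obtain ⟨φ, hφ, hclose⟩ := extraction_forall_of_frequently
    (P := fun (k n : ℕ) => dist (f^[n] x) (f^[n] y) < 1 / ((k : ℝ) + 1))
    (fun k => h _ (by positivity))
  obtain ⟨z, ψ, hψ, hlim⟩ := CompactSpace.tendsto_subseq (fun n => f^[φ n] x)
  refine ⟨z, ⟨φ ∘ ψ, hφ.comp hψ, hlim⟩, φ ∘ ψ, hφ.comp hψ, ?_⟩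
  refine hlim.congr_dist ?_
  refine squeeze_zero (fun _ => dist_nonneg) (fun j => (hclose (ψ j)).le) ?_
  exact (tendsto_one_div_add_atTop_nhds_zero_nat (𝕜 := ℝ)).comp hψ.tendsto_atTop

/-- If `f` is chain continuous on a set attracting the orbits of `x` and `y`, and these orbits
are proximal, then they are asymptotic. -/
theorem ChainContinuousOn.eventually_dist_lt {X : Type*} [MetricSpace X] [CompactSpace X]
    {f : X → X} (hf : Continuous f) {C : Set X} (hcc : ChainContinuousOn f C) {x y : X}
    (hx : omegaLim f x ⊆ C) (hy : omegaLim f y ⊆ C)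
    (hprox : ∀ ε > 0, ∃ᶠ n in atTop, dist (f^[n] x) (f^[n] y) < ε) {ε : ℝ} (hε : 0 < ε) :
    ∀ᶠ n in atTop, dist (f^[n] x) (f^[n] y) < 3 * ε := by
  obtain ⟨δ, hδ, hcc⟩ := hcc ε hε
  obtain ⟨η, hη, huc⟩ := Metric.uniformContinuous_iff.1
    (CompactSpace.uniformContinuous_of_continuous hf) (δ / 2) (half_pos hδ)
  obtain ⟨ρ, hρ, hρη, hρδ, hρε⟩ : ∃ ρ > 0, ρ ≤ η / 2 ∧ ρ ≤ δ / 2 ∧ ρ ≤ ε :=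
    ⟨min (η / 2) (min (δ / 2) ε), by positivity, min_le_left _ _,
      (min_le_right _ _).trans (min_le_left _ _), (min_le_right _ _).trans (min_le_right _ _)⟩
  obtain ⟨N, hN⟩ := eventually_atTop.1
    ((eventually_exists_dist_lt_of_omegaLim_subset hx hρ).and
      (eventually_exists_dist_lt_of_omegaLim_subset hy hρ))
  obtain ⟨n, hclose, hn⟩ := ((hprox ρ hρ).and_eventually (eventually_ge_atTop N)).exists
  choose a haC ha using fun i => (hN (n + i) (by omega)).1
  choose b hbC hb using fun i => (hN (n + i) (by omega)).2
  have step : ∀ {u p q : X} {i : ℕ}, dist (f^[n + i] u) p < η →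
      dist (f^[n + (i + 1)] u) q < ρ → dist (f p) q ≤ δ := by
    intro u p q i hp hq
    have h₁ := huc hp
    rw [← Function.iterate_succ_apply' f] at h₁
    have h₂ := dist_triangle_left (f p) q (f^[n + (i + 1)] u)
    rw [← add_assoc] at h₂ hq
    linarith
  have hab := hcc a (fun i => if i = 0 then a 0 else b i)
    (fun i => step ((ha i).trans_le (by linarith)) (ha (i + 1)))
    (fun i => by
      rcases Nat.eq_zero_or_pos i with rfl | h0
      · refine step (u := y) (i := 0) ?_ (hb 1)
        have h₁ := ha 0
        have h₂ := dist_triangle_left (f^[n + 0] y) (a 0) (f^[n + 0] x)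
        simp only [add_zero, if_true] at h₁ h₂ ⊢
        linarith
      · simpa [h0.ne'] using step ((hb i).trans_le (by linarith)) (hb (i + 1)))
    haC (fun i => by split_ifs; exacts [haC 0, hbC i]) (by simp)
  filter_upwards [eventually_gt_atTop n] with m hm
  obtain ⟨i, rfl⟩ := Nat.exists_eq_add_of_lt hm
  have h₁ := hab (i + 1)
  simp only [Nat.add_eq_zero_iff, one_ne_zero, and_false, if_false] at h₁
  have h₂ := ha (i + 1)
  have h₃ := hb (i + 1)
  rw [dist_comm] at h₃
  have h₄ := dist_triangle4 (f^[n + (i + 1)] x) (a (i + 1)) (b (i + 1)) (f^[n + (i + 1)] y)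
  rw [add_assoc]
  linarith

/-- Theorem 1.3 (2): if `(x,y)` is a scrambled pair for `f` for some `y`, then
`f|_C` is not chain continuous. -/
theorem stmt_5 {X : Type*} [MetricSpace X] [CompactSpace X] (f : X → X)
    (hf : Continuous f) (x : X) (C : Set X) (hC : IsChainComponent f C)
    (hω : omegaLim f x ⊆ C) (hscr : ∃ y : X, ScrambledPair f x y) :
    ¬ ChainContinuousOn f C := by
  obtain ⟨y, hsup, hinf⟩ := hscr
  intro hcc
  have hub : ∀ i : ℕ, dist (f^[i] x) (f^[i] y) ≤ Metric.diam (univ : Set X) := fun i =>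
    Metric.dist_le_diam_of_mem isCompact_univ.isBounded (mem_univ _) (mem_univ _)
  have hbdd : IsBoundedUnder (· ≤ ·) atTop (fun i : ℕ => dist (f^[i] x) (f^[i] y)) :=
    isBoundedUnder_of ⟨_, hub⟩
  have hbdd' : IsBoundedUnder (· ≥ ·) atTop (fun i : ℕ => dist (f^[i] x) (f^[i] y)) :=
    isBoundedUnder_of ⟨0, fun _ => dist_nonneg⟩
  have hprox : ∀ ε > 0, ∃ᶠ n in atTop, dist (f^[n] x) (f^[n] y) < ε := fun ε hε =>
    frequently_lt_of_liminf_lt hbdd.isCoboundedUnder_ge (hinf ▸ hε)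
  obtain ⟨z, hzx, hzy⟩ := exists_mem_omegaLim_inter_of_frequently hprox
  have hy := hC.omegaLim_subset hf (hω hzx) hzy
  have hlim := hcc.eventually_dist_lt hf hω hy hprox (div_pos hsup (by norm_num : (0 : ℝ) < 6))
  have hle := limsup_le_of_le hbdd'.isCoboundedUnder_le (hlim.mono fun _ h => h.le)
  linarith
end
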